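/- Let X be a real random variable with probability density f satisfying Rényi's condition and with f·log₂(1/f) Lebesgue integrable, and let F be its cumulative distribution function. Then the expected bit-consumption of the inversion method satisfies limsup_{ε→0⁺} ( N(ε) − log₂(1/ε) ) ≤ 𝔈(f) + 2. -/

import Mathlib

open MeasureTheory

/-- The entropy summand `t ↦ t·log₂(1/t)` (equal to `0` at `t = 0`). -/
noncomputable def entTerm (t : ℝ) : ℝ := t * Real.logb 2 (1 / t)

open Classical in
/-- The real-valued indicator of a proposition. -/
noncomputable def ind (P : Prop) : ℝ := if P then 1 else 0

/-- The (extended-real-valued) quantile function `F⁻¹(u) = inf{x : F(x) ≥ u}`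
(`+∞` when no such `x` exists, `−∞` when all `x` qualify). -/
noncomputable def quantile (F : ℝ → ℝ) (u : ℝ) : EReal :=
  sInf {y : EReal | ∃ x : ℝ, y = (x : EReal) ∧ u ≤ F x}

/-- `N(ε)`, the expected number of fair bits used by the bisection inversion method with
accuracy `ε`: `N(ε) = Σ_{t≥0} Σ_{i<2^t} 2^{−t}·1{F⁻¹((i+1)/2^t) − F⁻¹(i/2^t) > 2ε}`,
the indicator being `1` whenever the difference exceeds `2ε` (in particular when the
upper quantile is `+∞`). -/
noncomputable def inversionBits (F : ℝ → ℝ) (ε : ℝ) : ℝ :=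
  ∑' t : ℕ, ∑ i ∈ Finset.range (2 ^ t),
    ((2 : ℝ) ^ t)⁻¹ *
      ind (((2 * ε : ℝ) : EReal)
        < quantile F (((i : ℝ) + 1) / 2 ^ t) - quantile F ((i : ℝ) / 2 ^ t))

open Filter Topology

namespace InvBits

/-- The level-`n` grid cell `[m/n,(m+1)/n)`. -/
def cell (n : ℕ) (m : ℤ) : Set ℝ := {x | ⌊x * n⌋ = m}

/-- The mass of a grid cell. -/
noncomputable def cm (f : ℝ → ℝ) (n : ℕ) (m : ℤ) : ℝ := ∫ x in cell n m, f x

lemma cell_eq {n : ℕ} (hn : n ≠ 0) (m : ℤ) :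
    cell n m = Set.Ico ((m : ℝ) / n) (((m : ℝ) + 1) / n) := by
  have h : (0 : ℝ) < n := by positivity
  ext x
  simp only [cell, Set.mem_ofPred_eq, Set.mem_Ico, Int.floor_eq_iff, div_le_iff₀ h, lt_div_iff₀ h]

lemma measurableSet_cell (n : ℕ) (m : ℤ) : MeasurableSet (cell n m) := by
  have : Measurable fun x : ℝ => ⌊x * n⌋ := Int.measurable_floor.comp (by fun_prop)
  exact this (measurableSet_singleton m)

lemma iUnion_cell (n : ℕ) : ⋃ m, cell n m = Set.univ := by
  ext x; simp [cell]

lemma disjoint_cell (n : ℕ) : Pairwise (Function.onFun Disjoint (cell n)) := by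
  intro a b hab
  refine Set.disjoint_left.2 fun x hx hx' => hab ?_
  exact (show ⌊x * n⌋ = a from hx).symm.trans hx'

lemma volume_cell {n : ℕ} (hn : n ≠ 0) (m : ℤ) :
    volume (cell n m) = ENNReal.ofReal (1 / n) := by
  rw [cell_eq hn, Real.volume_Ico]; congr 1; ring

lemma hasSum_cell {g : ℝ → ℝ} (hg : Integrable g) (n : ℕ) :
    HasSum (fun m => ∫ x in cell n m, g x) (∫ x, g x) := by
  have := hasSum_integral_iUnion (f := g) (μ := volume) (measurableSet_cell n) (disjoint_cell n)
    hg.integrableOn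
  rwa [iUnion_cell, setIntegral_univ] at this

lemma integrable_of_cell {g : ℝ → ℝ} (n : ℕ) (hg : ∀ m, IntegrableOn g (cell n m))
    (hs : Summable fun m => ∫ x in cell n m, ‖g x‖) : Integrable g := by
  have := integrableOn_iUnion_of_summable_integral_norm hg hs
  rwa [iUnion_cell, integrableOn_univ] at this

lemma lintegral_cell (g : ℤ → ENNReal) {n : ℕ} (hn : n ≠ 0) :
    ∫⁻ x : ℝ, g ⌊x * n⌋ = ∑' m, g m * ENNReal.ofReal (1 / n) := by
  have := lintegral_iUnion (μ := volume) (measurableSet_cell n) (disjoint_cell n)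
    (fun x : ℝ => g ⌊x * n⌋)
  rw [iUnion_cell, setLIntegral_univ] at this
  rw [this]
  congr 1; ext m
  rw [setLIntegral_congr_fun (g := fun _ => g m) (measurableSet_cell n m), setLIntegral_const,
    volume_cell hn]
  intro x hx
  simp only [show ⌊x * n⌋ = m from hx]

lemma floor_of_mem_cell {n : ℕ} (hn : n ≠ 0) {m : ℤ} {x : ℝ} (hx : x ∈ cell n m) :
    ⌊x⌋ = m / n := by
  rw [← show ⌊x * n⌋ = m from hx, Int.mul_natCast_floor_div_cancel hn]

lemma cell_subset {n : ℕ} (hn : n ≠ 0) (m : ℤ) : cell n m ⊆ cell 1 (m / n) := by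
  intro x hx
  have := floor_of_mem_cell hn hx
  simpa [cell] using this

section
variable {f : ℝ → ℝ}

lemma cm_nonneg (hf0 : ∀ x, 0 ≤ f x) (n : ℕ) (m : ℤ) : 0 ≤ cm f n m :=
  integral_nonneg hf0

lemma cm_le (hf0 : ∀ x, 0 ≤ f x) (hfi : Integrable f) {n : ℕ} (hn : n ≠ 0) (m : ℤ) :
    cm f n m ≤ cm f 1 (m / n) :=
  setIntegral_mono_set hfi.integrableOn (Eventually.of_forall hf0) (cell_subset hn m).eventuallyLE

lemma cm_le_one (hf0 : ∀ x, 0 ≤ f x) (hfi : Integrable f) (h1 : ∫ x, f x = 1) (n : ℕ) (m : ℤ) :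
    cm f n m ≤ 1 := by
  rw [← h1]
  exact setIntegral_le_integral hfi (Eventually.of_forall hf0)

lemma hasSum_cm (hfi : Integrable f) (h1 : ∫ x, f x = 1) (n : ℕ) : HasSum (cm f n) 1 := by
  rw [← h1]; exact hasSum_cell hfi n

lemma setIntegral_cell_floor (a : ℤ → ℝ) (g : ℝ → ℝ) {n : ℕ} (hn : n ≠ 0) (m : ℤ) :
    ∫ x in cell n m, g x * a ⌊x⌋ = (∫ x in cell n m, g x) * a (m / n) := by
  rw [← integral_mul_const]
  refine setIntegral_congr_fun (measurableSet_cell n m) fun x hx => ?_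
  simp only [floor_of_mem_cell hn hx]

/-- Relative entropy integrand. -/
noncomputable def Psi (y P : ℝ) : ℝ :=
  y * Real.logb 2 (1 / P) + (P - y) / Real.log 2 - y * Real.logb 2 (1 / y)

lemma Psi_nonneg {y P : ℝ} (hy : 0 ≤ y) (hP : 0 ≤ P) (h : P = 0 → y = 0) : 0 ≤ Psi y P := by
  have hl : 0 < Real.log 2 := Real.log_pos (by norm_num)
  rcases hy.eq_or_lt with rfl | hy
  · simp only [Psi]; simp; positivity
  have hP' : 0 < P := lt_of_le_of_ne hP fun e => hy.ne' (h e.symm)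
  have h2 := Real.log_le_sub_one_of_pos (div_pos hP' hy)
  rw [Real.log_div hP'.ne' hy.ne'] at h2
  have h3 : y * (Real.log P - Real.log y) ≤ P - y := by
    calc _ ≤ y * (P / y - 1) := by gcongr
      _ = _ := by field_simp
  have : Psi y P = (P - y - y * (Real.log P - Real.log y)) / Real.log 2 := by
    simp only [Psi, Real.logb, one_div, Real.log_inv]; field_simp; ring
  rw [this]
  apply div_nonneg _ hl.le
  linarith

lemma entTerm_eq (t : ℝ) : entTerm t = Real.negMulLog t / Real.log 2 := by
  simp only [entTerm, Real.logb, one_div, Real.log_inv, Real.negMulLog]; ring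

lemma entTerm_nonneg {t : ℝ} (h0 : 0 ≤ t) (h1 : t ≤ 1) : 0 ≤ entTerm t := by
  rw [entTerm_eq]
  exact div_nonneg (Real.negMulLog_nonneg h0 h1) (Real.log_nonneg (by norm_num))

lemma continuous_Psi (P : ℝ) : Continuous fun y => Psi y P := by
  have : (fun y => Psi y P) = fun y =>
      y * Real.logb 2 (1 / P) + (P - y) / Real.log 2 - Real.negMulLog y / Real.log 2 := by
    ext y; rw [← entTerm_eq]; rfl
  rw [this]
  have := Real.continuous_negMulLog
  fun_prop

lemma ae_tendsto_cm (hfi : Integrable f) :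
    ∀ᵐ x : ℝ, Tendsto (fun n : ℕ => n * cm f n ⌊x * n⌋) atTop (𝓝 (f x)) := by
  filter_upwards [IsUnifLocDoublingMeasure.ae_tendsto_average volume hfi.locallyIntegrable 1]
    with x hx
  have key := hx (l := atTop) (fun n : ℕ => ((⌊x * n⌋ : ℝ) + 1 / 2) / n)
    (fun n : ℕ => 1 / (2 * n : ℝ)) ?_ ?_
  · refine key.congr' ?_
    filter_upwards [eventually_ge_atTop 1] with n hn
    have hn0 : n ≠ 0 := by omega
    have hnp : (0 : ℝ) < n := by positivity
    have e : Metric.closedBall (((⌊x * n⌋ : ℝ) + 1 / 2) / n) (1 / (2 * n : ℝ))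
        = Set.Icc ((⌊x * n⌋ : ℝ) / n) (((⌊x * n⌋ : ℝ) + 1) / n) := by
      rw [Real.closedBall_eq_Icc]
      congr 1 <;> field_simp <;> ring
    rw [e, setAverage_eq, cm, cell_eq hn0, integral_Icc_eq_integral_Ico, measureReal_def,
      Real.volume_Icc, ENNReal.toReal_ofReal]
    · rw [smul_eq_mul]; congr 1; field_simp; ring
    · rw [sub_nonneg]; gcongr; linarith
  · refine tendsto_nhdsWithin_iff.2 ⟨?_, ?_⟩
    · have : Tendsto (fun n : ℕ => (2 * n : ℝ)) atTop atTop :=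
        tendsto_natCast_atTop_atTop.const_mul_atTop (by norm_num)
      simp only [one_div]
      exact this.inv_tendsto_atTop
    · filter_upwards [eventually_ge_atTop 1] with n hn
      have hnp : (0 : ℝ) < n := by positivity
      simp only [Set.mem_Ioi]; positivity
  · filter_upwards [eventually_ge_atTop 1] with n hn
    have hnp : (0 : ℝ) < n := by positivity
    rw [Real.closedBall_eq_Icc]
    have h1 := Int.floor_le (x * n)
    have h2 := Int.lt_floor_add_one (x * n)
    constructor
    · rw [one_mul, show ((⌊x * n⌋ : ℝ) + 1 / 2) / n - 1 / (2 * n) = (⌊x * n⌋ : ℝ) / n by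
        field_simp; ring, div_le_iff₀ hnp]
      exact h1
    · rw [one_mul, show ((⌊x * n⌋ : ℝ) + 1 / 2) / n + 1 / (2 * n) = ((⌊x * n⌋ : ℝ) + 1) / n by
        field_simp; ring, le_div_iff₀ hnp]
      exact h2.le

lemma renyi (hf0 : ∀ x, 0 ≤ f x) (hfi : Integrable f) (h1 : ∫ x, f x = 1)
    (hP : Summable fun k : ℤ => entTerm (cm f 1 k))
    (hint : Integrable (fun x => f x * Real.logb 2 (1 / f x)) volume) {δ : ℝ} (hδ : 0 < δ) :
    ∀ᶠ n : ℕ in atTop, (Summable fun m => entTerm (cm f n m)) ∧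
      ∑' m, entTerm (cm f n m) ≤ (∫ x, f x * Real.logb 2 (1 / f x)) + Real.logb 2 n + δ := by
  have hl : 0 < Real.log 2 := Real.log_pos (by norm_num)
  have one0 : (1 : ℕ) ≠ 0 := one_ne_zero
  set L : ℤ → ℝ := fun k => Real.logb 2 (1 / cm f 1 k) with hL
  have hL0 : ∀ k, 0 ≤ L k := fun k => by
    rcases (cm_nonneg hf0 1 k).eq_or_lt with h | h
    · simp [hL, ← h]
    · exact Real.logb_nonneg (by norm_num) (by
        rw [le_div_iff₀ h, one_mul]; exact cm_le_one hf0 hfi h1 1 k)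
  have constOn : ∀ (a : ℤ → ℝ) (m : ℤ), ∀ x ∈ cell 1 m, a ⌊x⌋ = a m := by
    intro a m x hx
    rw [floor_of_mem_cell one0 hx]; simp
  -- f * L integrable
  have hfL : Integrable fun x => f x * L ⌊x⌋ := by
    refine integrable_of_cell 1 (fun m => ?_) ?_
    · refine IntegrableOn.congr_fun (f := fun x => f x * L m) (hfi.mul_const _).integrableOn
        (fun x hx => ?_) (measurableSet_cell 1 m)
      simp only [constOn L m x hx]
    · refine hP.congr fun m => ?_
      have : ∀ x, ‖f x * L ⌊x⌋‖ = f x * L ⌊x⌋ := fun x =>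
        Real.norm_of_nonneg (mul_nonneg (hf0 x) (hL0 _))
      simp only [this]
      rw [setIntegral_cell_floor L f one0]
      simp [entTerm, hL, cm]
  have hπ : Integrable fun x : ℝ => cm f 1 ⌊x⌋ := by
    refine integrable_of_cell 1 (fun m => ?_) ?_
    · refine IntegrableOn.congr_fun (f := fun x => cm f 1 m) ?_
        (fun x hx => ?_) (measurableSet_cell 1 m)
      · apply integrableOn_const
        rw [volume_cell one0]; simp
        simp
      simp only [constOn (cm f 1) m x hx]
    · refine (hasSum_cm hfi h1 1).summable.congr fun m => ?_
      have : ∀ x : ℝ, ‖cm f 1 ⌊x⌋‖ = 1 * cm f 1 ⌊x⌋ := fun x => by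
        rw [Real.norm_of_nonneg (cm_nonneg hf0 _ _), one_mul]
      simp only [this]
      rw [setIntegral_cell_floor (cm f 1) _ one0]
      simp [measureReal_def, volume_cell one0]
  set S := ∫ x, f x * L ⌊x⌋ with hS
  set E := ∫ x, f x * Real.logb 2 (1 / f x) with hE
  have ψint : Integrable fun x => Psi (f x) (cm f 1 ⌊x⌋) := by
    unfold Psi
    exact (hfL.add ((hπ.sub hfi).div_const _)).sub hint
  have intπ : ∫ x : ℝ, cm f 1 ⌊x⌋ = 1 := by
    refine (hasSum_cell hπ 1).unique ?_
    convert hasSum_cm hfi h1 1 using 2 with m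
    have := setIntegral_cell_floor (cm f 1) (fun _ => 1) one0 m
    simp only [one_mul] at this
    rw [this]
    simp [measureReal_def, volume_cell one0]
  have ψval : ∫ x, Psi (f x) (cm f 1 ⌊x⌋) = S - E := by
    have e1 : ∫ x, Psi (f x) (cm f 1 ⌊x⌋) = (∫ x, f x * L ⌊x⌋ + (cm f 1 ⌊x⌋ - f x) / Real.log 2)
        - ∫ x, f x * Real.logb 2 (1 / f x) :=
      integral_sub (hfL.add ((hπ.sub hfi).div_const _)) hint
    have e2 : (∫ x, f x * L ⌊x⌋ + (cm f 1 ⌊x⌋ - f x) / Real.log 2)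
        = (∫ x, f x * L ⌊x⌋) + ∫ x, (cm f 1 ⌊x⌋ - f x) / Real.log 2 :=
      integral_add hfL ((hπ.sub hfi).div_const _)
    rw [e1, e2, integral_div, integral_sub hπ hfi, intπ, h1]
    simp [hS, hE]
  have aet := ae_tendsto_cm hfi
  have wnn : ∀ n : ℕ, n ≠ 0 → ∀ m : ℤ, 0 ≤ Psi (n * cm f n m) (cm f 1 (m / n)) := by
    intro n hn m
    refine Psi_nonneg (mul_nonneg (by positivity) (cm_nonneg hf0 _ _)) (cm_nonneg hf0 _ _) ?_
    intro h
    have := cm_le hf0 hfi hn m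
    have h' := cm_nonneg hf0 n m
    rw [show cm f n m = 0 by linarith, mul_zero]
  have aet2 : ∀ᵐ x : ℝ, Tendsto (fun n : ℕ => Psi (n * cm f n ⌊x * n⌋) (cm f 1 (⌊x * n⌋ / n)))
      atTop (𝓝 (Psi (f x) (cm f 1 ⌊x⌋))) := by
    filter_upwards [aet] with x hx
    refine (((continuous_Psi (cm f 1 ⌊x⌋)).tendsto (f x)).comp hx).congr' ?_
    filter_upwards [eventually_ge_atTop 1] with n hn
    simp only [Function.comp]
    rw [Int.mul_natCast_floor_div_cancel (by omega)]
  have ψnn : 0 ≤ᵐ[volume] fun x => Psi (f x) (cm f 1 ⌊x⌋) := by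
    filter_upwards [aet2] with x hx
    refine ge_of_tendsto hx ?_
    filter_upwards [eventually_ge_atTop 1] with n hn
    exact wnn n (by omega) _
  have fatou : ENNReal.ofReal (S - E) ≤ liminf (fun n : ℕ => ∫⁻ x : ℝ,
      ENNReal.ofReal (Psi (n * cm f n ⌊x * n⌋) (cm f 1 (⌊x * n⌋ / n)))) atTop := by
    rw [← ψval, ofReal_integral_eq_lintegral_ofReal ψint ψnn]
    refine le_trans (le_of_eq ?_) (lintegral_liminf_le ?_)
    · refine lintegral_congr_ae ?_
      filter_upwards [aet2] with x hx
      exact ((ENNReal.continuous_ofReal.tendsto _).comp hx).liminf_eq.symm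
    · intro n
      have h1 : Measurable fun x : ℝ => ⌊x * n⌋ := Int.measurable_floor.comp (by fun_prop)
      exact (measurable_from_top (f := fun m : ℤ =>
        ENNReal.ofReal (Psi (n * cm f n m) (cm f 1 (m / n))))).comp h1
  -- discrete identity
  have disc : ∀ n : ℕ, n ≠ 0 → (Summable fun m => entTerm (cm f n m)) ∧
      (∫⁻ x : ℝ, ENNReal.ofReal (Psi (n * cm f n ⌊x * n⌋) (cm f 1 (⌊x * n⌋ / n))))
        = ENNReal.ofReal (S + Real.logb 2 n - ∑' m, entTerm (cm f n m)) ∧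
      0 ≤ S + Real.logb 2 n - ∑' m, entTerm (cm f n m) := by
    intro n hn
    have hnp : (0 : ℝ) < n := by positivity
    have a1 : HasSum (fun m : ℤ => cm f n m * L (m / n)) S := by
      convert hasSum_cell hfL n using 2 with m
      rw [setIntegral_cell_floor L f hn]; rfl
    have a2 : HasSum (fun m : ℤ => cm f 1 (m / n) / n) 1 := by
      rw [← intπ]
      convert hasSum_cell hπ n using 2 with m
      have := setIntegral_cell_floor (cm f 1) (fun _ => 1) hn m
      simp only [one_mul] at this
      rw [this]
      simp [measureReal_def, volume_cell hn]
      ring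
    have a3 := hasSum_cm hfi h1 n
    have a4 : HasSum (fun m : ℤ => cm f n m * L (m / n) + cm f n m * Real.logb 2 n
        + (cm f 1 (m / n) / n - cm f n m) / Real.log 2) (S + Real.logb 2 n) := by
      have := (a1.add (a3.mul_right (Real.logb 2 n))).add ((a2.sub a3).div_const (Real.log 2))
      simpa using this
    have ident : ∀ m : ℤ, cm f n m * L (m / n) + cm f n m * Real.logb 2 n
        + (cm f 1 (m / n) / n - cm f n m) / Real.log 2
        = Psi (n * cm f n m) (cm f 1 (m / n)) * (1 / n) + entTerm (cm f n m) := by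
      intro m
      simp only [Psi, entTerm, hL]
      rcases (cm_nonneg hf0 n m).eq_or_lt with h | h
      · rw [← h]; simp; field_simp
      · rw [one_div (n * cm f n m), Real.logb_inv, Real.logb_mul hnp.ne' h.ne', one_div (cm f n m),
          Real.logb_inv]
        field_simp
        ring
    have en : ∀ m, 0 ≤ entTerm (cm f n m) := fun m =>
      entTerm_nonneg (cm_nonneg hf0 _ _) (cm_le_one hf0 hfi h1 _ _)
    have wn : ∀ m, 0 ≤ Psi (n * cm f n m) (cm f 1 (m / n)) * (1 / n) := fun m =>
      mul_nonneg (wnn n hn m) (by positivity)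
    simp only [ident] at a4
    have s1 : Summable fun m => entTerm (cm f n m) :=
      Summable.of_nonneg_of_le en (fun m => by linarith [wn m]) a4.summable
    refine ⟨s1, ?_⟩
    have a5 := a4.sub s1.hasSum
    simp only [add_sub_cancel_right] at a5
    refine ⟨?_, a5.nonneg wn⟩
    rw [lintegral_cell (fun m : ℤ => ENNReal.ofReal (Psi (n * cm f n m) (cm f 1 (m / n)))) hn,
      ← a5.tsum_eq, ENNReal.ofReal_tsum_of_nonneg wn a5.summable]
    refine tsum_congr fun m => ?_
    rw [ENNReal.ofReal_mul (wnn n hn m)]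
  rcases lt_or_ge 0 (S - E) with hpos | hneg
  · have : ENNReal.ofReal (S - E - δ) < ENNReal.ofReal (S - E) :=
      (ENNReal.ofReal_lt_ofReal_iff hpos).2 (by linarith)
    have := eventually_lt_of_lt_liminf (this.trans_le fatou)
    filter_upwards [this, eventually_ge_atTop 1] with n h2 hn
    obtain ⟨d1, d2, d3⟩ := disc n (by omega)
    refine ⟨d1, ?_⟩
    rw [d2] at h2
    by_contra hc
    exact absurd h2 (not_lt.2 (ENNReal.ofReal_le_ofReal (by linarith)))
  · filter_upwards [eventually_ge_atTop 1] with n hn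
    obtain ⟨d1, d2, d3⟩ := disc n (by omega)
    exact ⟨d1, by linarith⟩
end
end InvBits

namespace InvBits
open Classical

lemma sum_min_le {p : ℝ} (h0 : 0 ≤ p) (h1 : p ≤ 1) (T : ℕ) :
    ∑ t ∈ Finset.range T, min p (2 * ((2 : ℝ) ^ t)⁻¹) ≤ entTerm p + 3 * p := by
  rcases h0.eq_or_lt with rfl | hp
  · simp [entTerm]
  set a := Real.logb 2 (1 / p) with ha
  have ha0 : 0 ≤ a := Real.logb_nonneg (by norm_num) (by rw [le_div_iff₀ hp]; linarith)
  set n := ⌊a⌋₊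
  have hn1 : (n : ℝ) ≤ a := Nat.floor_le ha0
  have hn2 : a < n + 1 := Nat.lt_floor_add_one a
  have geo : ∀ T : ℕ, ∑ s ∈ Finset.range T, 2 * ((2 : ℝ) ^ (n + 2 + s))⁻¹
      = ((2 : ℝ) ^ n)⁻¹ * (1 - ((2 : ℝ) ^ T)⁻¹) := by
    intro T
    induction T with
    | zero => simp
    | succ k ih => rw [Finset.sum_range_succ, ih]; field_simp; ring
  have e1 : ((2 : ℝ) ^ n)⁻¹ ≤ p * (1 + (a - n)) := by
    have e2 : (2 : ℝ) ^ (a - n) ≤ 1 + (a - n) := by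
      have := rpow_one_add_le_one_add_mul_self (s := 1) (by norm_num) (p := a - n)
        (by linarith) (by linarith)
      norm_num at this ⊢
      linarith
    have e3 : (2 : ℝ) ^ a = 1 / p := Real.rpow_logb (by norm_num) (by norm_num) (by positivity)
    rw [Real.rpow_sub (by norm_num), e3, Real.rpow_natCast] at e2
    calc ((2 : ℝ) ^ n)⁻¹ = p * (1 / p / 2 ^ n) := by field_simp
      _ ≤ _ := by gcongr
  calc ∑ t ∈ Finset.range T, min p (2 * ((2 : ℝ) ^ t)⁻¹)
      ≤ ∑ t ∈ Finset.range (n + 2 + T), min p (2 * ((2 : ℝ) ^ t)⁻¹) := by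
        refine Finset.sum_le_sum_of_subset_of_nonneg ?_ fun t _ _ => le_min h0 (by positivity)
        intro t; simp only [Finset.mem_range]; omega
    _ = ∑ t ∈ Finset.range (n + 2), min p (2 * ((2 : ℝ) ^ t)⁻¹)
        + ∑ s ∈ Finset.range T, min p (2 * ((2 : ℝ) ^ (n + 2 + s))⁻¹) :=
        Finset.sum_range_add _ _ _
    _ ≤ ∑ t ∈ Finset.range (n + 2), p + ∑ s ∈ Finset.range T, 2 * ((2 : ℝ) ^ (n + 2 + s))⁻¹ := by
        gcongr
        · exact min_le_left _ _
        · exact min_le_right _ _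
    _ ≤ (n + 2) * p + ((2 : ℝ) ^ n)⁻¹ := by
        rw [geo]; simp only [Finset.sum_const, Finset.card_range, nsmul_eq_mul]
        push_cast
        gcongr
        have : 0 ≤ ((2 : ℝ) ^ n)⁻¹ * ((2 : ℝ) ^ T)⁻¹ := by positivity
        linarith
    _ ≤ (n + 2) * p + p * (1 + (a - n)) := by gcongr
    _ = entTerm p + 3 * p := by simp only [entTerm, ← ha]; ring

/-- A bad dyadic cell. -/
def bad (F : ℝ → ℝ) (ε : ℝ) (t i : ℕ) : Prop :=
  ((2 * ε : ℝ) : EReal) < quantile F (((i : ℝ) + 1) / 2 ^ t) - quantile F ((i : ℝ) / 2 ^ t)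

/-- Level-`t` contribution. -/
noncomputable def bt (F : ℝ → ℝ) (ε : ℝ) (t : ℕ) : ℝ :=
  ∑ i ∈ Finset.range (2 ^ t), ((2 : ℝ) ^ t)⁻¹ * ind (bad F ε t i)

lemma inversionBits_eq (F : ℝ → ℝ) (ε : ℝ) : inversionBits F ε = ∑' t, bt F ε t := rfl

lemma ind_nonneg (P : Prop) : 0 ≤ ind P := by unfold ind; split_ifs <;> norm_num

lemma bt_nonneg (F : ℝ → ℝ) (ε : ℝ) (t : ℕ) : 0 ≤ bt F ε t :=
  Finset.sum_nonneg fun i _ => mul_nonneg (by positivity) (ind_nonneg _)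

lemma bt_eq (F : ℝ → ℝ) (ε : ℝ) (t : ℕ) :
    bt F ε t = ((Finset.range (2 ^ t)).filter (bad F ε t)).card * ((2 : ℝ) ^ t)⁻¹ := by
  unfold bt
  rw [← Finset.mul_sum, mul_comm]
  congr 1
  simp only [ind, Finset.sum_boole]

lemma not_bad {F : ℝ → ℝ} (hm : Monotone F) {ε a b : ℝ} (hab : b - a ≤ 2 * ε) {t i : ℕ}
    (h1 : F a < (i : ℝ) / 2 ^ t) (h2 : ((i : ℝ) + 1) / 2 ^ t ≤ F b) : ¬ bad F ε t i := by
  unfold bad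
  rw [not_lt]
  have q1 : quantile F (((i : ℝ) + 1) / 2 ^ t) ≤ (b : EReal) := sInf_le ⟨b, rfl, h2⟩
  have q2 : (a : EReal) ≤ quantile F ((i : ℝ) / 2 ^ t) := by
    refine le_sInf ?_
    rintro y ⟨x, rfl, hx⟩
    rw [EReal.coe_le_coe_iff]
    by_contra hc
    exact absurd (hm (not_le.1 hc).le) (not_le.2 (h1.trans_le hx))
  refine (EReal.sub_le_sub q1 q2).trans ?_
  rw [← EReal.coe_sub]
  exact_mod_cast hab

lemma bt_le {F : ℝ → ℝ} (hm : Monotone F) (hbot : Tendsto F atBot (𝓝 0))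
    (htop : Tendsto F atTop (𝓝 1)) {ε : ℝ} {n : ℕ} (hn : n ≠ 0) (hε : (1 : ℝ) / n ≤ 2 * ε)
    (t : ℕ) :
    ENNReal.ofReal (bt F ε t) ≤ ∑' m : ℤ, ENNReal.ofReal
      (min (F (((m : ℝ) + 1) / n) - F ((m : ℝ) / n)) (2 * ((2 : ℝ) ^ t)⁻¹)) := by
  have hnp : (0 : ℝ) < n := by positivity
  have ht0 : (2 ^ t : ℕ) ≠ 0 := by positivity
  have htp : (0 : ℝ) < 2 ^ t := by positivity
  set s := (Finset.range (2 ^ t)).filter (bad F ε t) with hs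
  set B : Set ℝ := ⋃ i ∈ s, cell (2 ^ t) (i : ℤ) with hB
  have vB : volume B = ENNReal.ofReal (bt F ε t) := by
    rw [hB, measure_biUnion_finset, bt_eq, ← hs]
    · simp only [volume_cell ht0, Finset.sum_const, nsmul_eq_mul]
      rw [ENNReal.ofReal_mul (by positivity), ENNReal.ofReal_natCast]
      simp
    · intro i _ j _ hij
      exact disjoint_cell (2 ^ t) (by exact_mod_cast hij)
    · intro i _; exact measurableSet_cell _ _
  set J : ℤ → Set ℝ := fun m => Set.Ico (F ((m : ℝ) / n)) (F (((m : ℝ) + 1) / n)) with hJ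
  have cover : B ⊆ {0} ∪ ⋃ m, B ∩ J m := by
    intro u hu
    have hu' := hu
    simp only [hB, Set.mem_iUnion, hs, Finset.mem_filter, Finset.mem_range] at hu'
    obtain ⟨i, ⟨hi, _⟩, hic⟩ := hu'
    rw [cell_eq ht0] at hic
    push_cast at hic
    have hu0 : 0 ≤ u := le_trans (by positivity) hic.1
    have hu1 : u < 1 := hic.2.trans_le (by
      rw [div_le_one htp]; exact_mod_cast hi)
    rcases hu0.eq_or_lt with h | hu0
    · left; exact h.symm
    right
    have E1 : ∃ b : ℤ, ∀ z : ℤ, F ((z : ℝ) / n) ≤ u → z ≤ b := by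
      obtain ⟨x, hx⟩ := (htop.eventually (lt_mem_nhds hu1)).exists
      refine ⟨⌈x * n⌉, fun z hz => ?_⟩
      by_contra hc
      have h1 : (⌈x * n⌉ : ℝ) < z := by exact_mod_cast not_le.1 hc
      have h2 : x ≤ z / n := by rw [le_div_iff₀ hnp]; linarith [Int.le_ceil (x * n)]
      linarith [hm h2]
    have E2 : ∃ z : ℤ, F ((z : ℝ) / n) ≤ u := by
      obtain ⟨x, hx⟩ := (hbot.eventually (gt_mem_nhds hu0)).exists
      refine ⟨⌊x * n⌋, le_trans (hm ?_) hx.le⟩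
      rw [div_le_iff₀ hnp]; exact Int.floor_le _
    obtain ⟨m, hm1, hm2⟩ := Int.exists_greatest_of_bdd E1 E2
    refine Set.mem_iUnion.2 ⟨m, hu, hm1, ?_⟩
    by_contra hc
    have := hm2 (m + 1) (by push_cast; exact not_lt.1 hc)
    omega
  calc ENNReal.ofReal (bt F ε t) = volume B := vB.symm
    _ ≤ volume ({0} ∪ ⋃ m, B ∩ J m) := measure_mono cover
    _ ≤ volume {(0 : ℝ)} + volume (⋃ m, B ∩ J m) := measure_union_le _ _
    _ ≤ ∑' m, volume (B ∩ J m) := by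
        rw [Real.volume_singleton, zero_add]; exact measure_iUnion_le _
    _ ≤ _ := by
        refine ENNReal.tsum_le_tsum fun m => ?_
        rw [ENNReal.ofReal_min]
        refine le_min ?_ ?_
        · rw [← Real.volume_Ico]; exact measure_mono Set.inter_subset_right
        · have sub : B ∩ J m ⊆ cell (2 ^ t) ⌊F ((m : ℝ) / n) * (2 ^ t : ℕ)⌋ ∪
              cell (2 ^ t) ⌊F (((m : ℝ) + 1) / n) * (2 ^ t : ℕ)⌋ := by
            rintro u ⟨hu, huJ⟩
            simp only [hB, Set.mem_iUnion, hs, Finset.mem_filter, Finset.mem_range] at hu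
            obtain ⟨i, ⟨hi, hbad⟩, hic⟩ := hu
            have hfl : ⌊u * (2 ^ t : ℕ)⌋ = (i : ℤ) := hic
            rw [cell_eq ht0] at hic
            push_cast at hic
            have key : (i : ℝ) / 2 ^ t ≤ F ((m : ℝ) / n) ∨
                F (((m : ℝ) + 1) / n) < ((i : ℝ) + 1) / 2 ^ t := by
              by_contra hc
              push Not at hc
              exact not_bad hm (a := (m : ℝ) / n) (b := ((m : ℝ) + 1) / n)
                (le_trans (le_of_eq (by ring)) hε) hc.1 hc.2 hbad
            have h1 := huJ.1
            have h2 := huJ.2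
            rcases key with h | h
            · left
              refine hfl.trans (Eq.symm ?_)
              rw [Int.floor_eq_iff]
              push_cast
              rw [← div_le_iff₀ htp, ← lt_div_iff₀ htp]
              exact ⟨h, h1.trans_lt hic.2⟩
            · right
              refine hfl.trans (Eq.symm ?_)
              rw [Int.floor_eq_iff]
              push_cast
              rw [← div_le_iff₀ htp, ← lt_div_iff₀ htp]
              exact ⟨hic.1.trans h2.le, h⟩
          refine (measure_mono sub).trans ((measure_union_le _ _).trans ?_)
          rw [volume_cell ht0, volume_cell ht0, ← ENNReal.ofReal_add (by positivity) (by positivity)]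
          refine ENNReal.ofReal_le_ofReal (le_of_eq ?_)
          push_cast; ring

lemma sum_bt_le {F : ℝ → ℝ} (hm : Monotone F) (hbot : Tendsto F atBot (𝓝 0))
    (htop : Tendsto F atTop (𝓝 1)) {ε : ℝ} {n : ℕ} (hn : n ≠ 0) (hε : (1 : ℝ) / n ≤ 2 * ε)
    {p : ℤ → ℝ} (hp : ∀ m : ℤ, F (((m : ℝ) + 1) / n) - F ((m : ℝ) / n) = p m)
    (hp0 : ∀ m, 0 ≤ p m) (hp1 : ∀ m, p m ≤ 1) (hs : HasSum p 1)
    (he : Summable fun m => entTerm (p m)) (T : ℕ) :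
    ∑ t ∈ Finset.range T, bt F ε t ≤ ∑' m, entTerm (p m) + 3 := by
  have hsum : HasSum (fun m => entTerm (p m) + 3 * p m) (∑' m, entTerm (p m) + 3) := by
    simpa using he.hasSum.add (hs.mul_left 3)
  have hnn : ∀ m, 0 ≤ entTerm (p m) + 3 * p m := fun m =>
    add_nonneg (entTerm_nonneg (hp0 m) (hp1 m)) (mul_nonneg (by norm_num) (hp0 m))
  rw [← ENNReal.ofReal_le_ofReal_iff (hsum.nonneg hnn),
    ENNReal.ofReal_sum_of_nonneg fun t _ => bt_nonneg F ε t, ← hsum.tsum_eq,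
    ENNReal.ofReal_tsum_of_nonneg hnn hsum.summable]
  calc _ ≤ ∑ t ∈ Finset.range T, ∑' m : ℤ, ENNReal.ofReal (min (p m) (2 * ((2 : ℝ) ^ t)⁻¹)) := by
        refine Finset.sum_le_sum fun t _ => ?_
        simpa only [hp] using bt_le hm hbot htop hn hε t
    _ = ∑' m : ℤ, ∑ t ∈ Finset.range T, ENNReal.ofReal (min (p m) (2 * ((2 : ℝ) ^ t)⁻¹)) :=
        (Summable.tsum_finsetSum fun _ _ => ENNReal.summable).symm
    _ ≤ _ := by
        refine ENNReal.tsum_le_tsum fun m => ?_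
        rw [← ENNReal.ofReal_sum_of_nonneg fun t _ => le_min (hp0 m) (by positivity)]
        exact ENNReal.ofReal_le_ofReal (sum_min_le (hp0 m) (hp1 m) T)

end InvBits

namespace InvBits
open Classical

section
variable {f F : ℝ → ℝ}

lemma F_mono (hf0 : ∀ x, 0 ≤ f x) (hfi : Integrable f) (hF : ∀ x, F x = ∫ y in Set.Iic x, f y) :
    Monotone F := by
  intro a b hab
  rw [hF, hF]
  exact setIntegral_mono_set hfi.integrableOn (Eventually.of_forall hf0)
    (Set.Iic_subset_Iic.2 hab).eventuallyLE

lemma F_cont (hfi : Integrable f) (hF : ∀ x, F x = ∫ y in Set.Iic x, f y) : Continuous F := by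
  have : F = fun x => F 0 + ∫ y in (0 : ℝ)..x, f y := by
    ext x
    rw [← intervalIntegral.integral_Iic_sub_Iic hfi.integrableOn hfi.integrableOn, hF, hF]
    ring
  rw [this]
  exact continuous_const.add
    (intervalIntegral.continuous_primitive (fun a b => hfi.intervalIntegrable) 0)

lemma exists_F_eq (hc : Continuous F) (hbot : Tendsto F atBot (𝓝 0))
    (htop : Tendsto F atTop (𝓝 1)) {c : ℝ} (h0 : 0 < c) (h1 : c < 1) : ∃ x, F x = c := by
  refine mem_range_of_exists_le_of_exists_ge hc ?_ ?_
  · obtain ⟨x, hx⟩ := (hbot.eventually (gt_mem_nhds h0)).exists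
    exact ⟨x, hx.le⟩
  · obtain ⟨x, hx⟩ := (htop.eventually (lt_mem_nhds h1)).exists
    exact ⟨x, hx.le⟩

lemma mass_ge (hf0 : ∀ x, 0 ≤ f x) (hfi : Integrable f) (h1 : ∫ x, f x = 1)
    (hF : ∀ x, F x = ∫ y in Set.Iic x, f y) (hbot : Tendsto F atBot (𝓝 0))
    (htop : Tendsto F atTop (𝓝 1)) {c d : ℝ} (hc0 : 0 ≤ c) (hcd : c ≤ d) (hd : d ≤ 1) :
    d - c ≤ ∫ x in F ⁻¹' Set.Ico c d, f x := by
  have hm := F_mono hf0 hfi hF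
  have hcont := F_cont hfi hF
  have hF0 : ∀ x, 0 ≤ F x := fun x => by rw [hF]; exact integral_nonneg hf0
  have mono : ∀ {s t : Set ℝ}, s ⊆ t → ∫ x in s, f x ≤ ∫ x in t, f x := fun h =>
    setIntegral_mono_set hfi.integrableOn (Eventually.of_forall hf0) h.eventuallyLE
  have up : ∫ x in F ⁻¹' Set.Iio c, f x ≤ c := by
    rcases hc0.eq_or_lt with h | h
    · have : F ⁻¹' Set.Iio c = ∅ := by
        ext x; simp [← h, hF0 x]
      rw [this]; simpa using hc0
    rcases lt_or_ge c 1 with h' | h'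
    · obtain ⟨y, hy⟩ := exists_F_eq hcont hbot htop h h'
      rw [← hy, hF y]
      refine mono fun x hx => ?_
      by_contra hxy
      have := hm (not_le.1 hxy).le
      rw [← hF y] at hx
      exact absurd hx (not_lt.2 this)
    · refine le_trans ?_ h'
      rw [← h1]
      exact setIntegral_le_integral hfi (Eventually.of_forall hf0)
  have low : d ≤ ∫ x in F ⁻¹' Set.Iio d, f x := by
    refine le_of_forall_lt fun d' hd' => ?_
    rcases lt_or_ge 0 d with h | h
    · obtain ⟨e, he1, he2⟩ := exists_between (max_lt hd' h)
      obtain ⟨y, hy⟩ := exists_F_eq hcont hbot htop ((le_max_right _ _).trans_lt he1)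
        (he2.trans_le hd)
      refine ((le_max_left _ _).trans_lt he1).trans_le ?_
      rw [← hy, hF y]
      refine mono fun x hx => ?_
      exact (hm hx).trans_lt (hy ▸ he2)
    · exact hd'.trans_le (h.trans (integral_nonneg hf0))
  have e : F ⁻¹' Set.Ico c d = F ⁻¹' Set.Iio d \ F ⁻¹' Set.Iio c := by
    ext x; simp [and_comm]
  rw [e, setIntegral_sdiff (hcont.measurable measurableSet_Iio) hfi.integrableOn]
  · linarith
  · intro x hx; exact lt_of_lt_of_le hx hcd

lemma vol_good (hm : Monotone F) {ε : ℝ} {t i : ℕ} (h : ¬ bad F ε t i) :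
    volume (F ⁻¹' Set.Ico ((i : ℝ) / 2 ^ t) (((i : ℝ) + 1) / 2 ^ t)) ≤ ENNReal.ofReal (2 * ε) := by
  unfold bad at h
  rw [not_lt] at h
  refine (Real.volume_le_diam _).trans (Metric.ediam_le fun x hx y hy => ?_)
  have lo : ∀ z ∈ F ⁻¹' Set.Ico ((i : ℝ) / 2 ^ t) (((i : ℝ) + 1) / 2 ^ t),
      quantile F ((i : ℝ) / 2 ^ t) ≤ (z : EReal) := fun z hz => sInf_le ⟨z, rfl, hz.1⟩
  have hi : ∀ z ∈ F ⁻¹' Set.Ico ((i : ℝ) / 2 ^ t) (((i : ℝ) + 1) / 2 ^ t),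
      (z : EReal) ≤ quantile F (((i : ℝ) + 1) / 2 ^ t) := fun z hz => by
    refine le_sInf ?_
    rintro w ⟨x', rfl, hx'⟩
    rw [EReal.coe_le_coe_iff]
    by_contra hc
    exact absurd (hm (not_le.1 hc).le) (not_le.2 (hz.2.trans_le hx'))
  have d : ∀ a ∈ F ⁻¹' Set.Ico ((i : ℝ) / 2 ^ t) (((i : ℝ) + 1) / 2 ^ t),
      ∀ b ∈ F ⁻¹' Set.Ico ((i : ℝ) / 2 ^ t) (((i : ℝ) + 1) / 2 ^ t), a - b ≤ 2 * ε := by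
    intro a ha b hb
    have := (EReal.sub_le_sub (hi a ha) (lo b hb)).trans h
    rw [← EReal.coe_sub] at this
    exact_mod_cast this
  rw [edist_dist, Real.dist_eq]
  refine ENNReal.ofReal_le_ofReal (abs_le.2 ⟨?_, d x hx y hy⟩)
  linarith [d y hy x hx]

lemma good_le (hf0 : ∀ x, 0 ≤ f x) (hfi : Integrable f) (h1 : ∫ x, f x = 1)
    (hF : ∀ x, F x = ∫ y in Set.Iic x, f y) (hbot : Tendsto F atBot (𝓝 0))
    (htop : Tendsto F atTop (𝓝 1)) {ε K : ℝ} (hε : 0 < ε) (hK : 0 ≤ K) (t : ℕ) :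
    1 - bt F ε t ≤ (∫ x, max (f x - K) 0) + K * (2 * ε) * 2 ^ t := by
  have hm := F_mono hf0 hfi hF
  have hcont := F_cont hfi hF
  have htp : (0 : ℝ) < 2 ^ t := by positivity
  have ht0 : (2 ^ t : ℕ) ≠ 0 := by positivity
  have hgi : Integrable fun x => max (f x - K) 0 := by
    refine hfi.mono' ((hfi.aestronglyMeasurable.sub aestronglyMeasurable_const).sup
      aestronglyMeasurable_const) (Eventually.of_forall fun x => ?_)
    rw [Real.norm_of_nonneg (le_max_right _ _)]
    exact max_le (by linarith) (hf0 x)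
  set G := (Finset.range (2 ^ t)).filter (fun i => ¬ bad F ε t i) with hG
  have hcard : 1 - bt F ε t = G.card * ((2 : ℝ) ^ t)⁻¹ := by
    have := Finset.card_filter_add_card_filter_not (s := Finset.range (2 ^ t)) (bad F ε t)
    rw [Finset.card_range] at this
    have h2 : (((Finset.range (2 ^ t)).filter (bad F ε t)).card : ℝ) + G.card = 2 ^ t := by
      exact_mod_cast this
    rw [bt_eq]
    field_simp
    linarith
  have hGle : (G.card : ℝ) ≤ 2 ^ t := by
    have := Finset.card_filter_le (Finset.range (2 ^ t)) (fun i => ¬ bad F ε t i)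
    rw [Finset.card_range] at this
    exact_mod_cast this
  set A : ℕ → Set ℝ := fun i => F ⁻¹' Set.Ico ((i : ℝ) / 2 ^ t) (((i : ℝ) + 1) / 2 ^ t) with hA
  have hAm : ∀ i, MeasurableSet (A i) := fun i => hcont.measurable measurableSet_Ico
  have hAe : ∀ i : ℕ, A i = F ⁻¹' cell (2 ^ t) (i : ℤ) := fun i => by
    rw [cell_eq ht0]; push_cast; rfl
  have hAd : ∀ i j, i ≠ j → Disjoint (A i) (A j) := by
    intro i j hij
    rw [hAe, hAe]
    exact (disjoint_cell (2 ^ t) (by exact_mod_cast hij)).preimage F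
  have each : ∀ i ∈ G, ((2 : ℝ) ^ t)⁻¹ ≤ (∫ x in A i, max (f x - K) 0) + K * (2 * ε) := by
    intro i hi
    obtain ⟨hi1, hi2⟩ := Finset.mem_filter.1 hi
    rw [Finset.mem_range] at hi1
    have v := vol_good hm hi2
    have hfin : volume (A i) ≠ ⊤ := ne_top_of_le_ne_top ENNReal.ofReal_ne_top v
    have m1 : ((2 : ℝ) ^ t)⁻¹ ≤ ∫ x in A i, f x := by
      refine le_trans (le_of_eq ?_) (mass_ge hf0 hfi h1 hF hbot htop
        (c := (i : ℝ) / 2 ^ t) (d := ((i : ℝ) + 1) / 2 ^ t) (by positivity) (by gcongr; linarith) ?_)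
      · ring
      · rw [div_le_one htp]; exact_mod_cast hi1
    have m2 : ∫ x in A i, f x ≤ ∫ x in A i, (max (f x - K) 0 + K) := by
      refine setIntegral_mono_on hfi.integrableOn
        (hgi.integrableOn.add (integrableOn_const hfin)) (hAm i) fun x _ => ?_
      linarith [le_max_left (f x - K) 0]
    rw [integral_add hgi.integrableOn (integrableOn_const hfin), setIntegral_const] at m2
    have m3 : volume.real (A i) ≤ 2 * ε := ENNReal.toReal_le_of_le_ofReal (by positivity) v
    have m4 : volume.real (A i) • K ≤ K * (2 * ε) := by
      rw [smul_eq_mul, mul_comm]; gcongr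
    linarith
  rw [hcard]
  calc (G.card : ℝ) * ((2 : ℝ) ^ t)⁻¹ = ∑ i ∈ G, ((2 : ℝ) ^ t)⁻¹ := by simp
    _ ≤ ∑ i ∈ G, ((∫ x in A i, max (f x - K) 0) + K * (2 * ε)) := Finset.sum_le_sum each
    _ = (∫ x in ⋃ i ∈ G, A i, max (f x - K) 0) + K * (2 * ε) * G.card := by
        rw [Finset.sum_add_distrib, integral_biUnion_finset _ (fun i _ => hAm i)
          (fun i _ j _ hij => hAd i j hij) (fun i _ => hgi.integrableOn)]
        simp; ring
    _ ≤ _ := by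
        refine add_le_add ?_ (mul_le_mul_of_nonneg_left hGle (by positivity))
        exact setIntegral_le_integral hgi (Eventually.of_forall fun x => le_max_right _ _)

lemma sum_max_le {y : ℝ} (hy : 0 ≤ y) (M : ℕ) :
    ∑ j ∈ Finset.range M, max (y - (3 / 2 : ℝ) ^ (j + 1)) 0
      ≤ Real.log 2 / Real.log (3 / 2) * |y * Real.logb 2 (1 / y)| := by
  have hl : 0 < Real.log 2 := Real.log_pos (by norm_num)
  have hl' : 0 < Real.log (3 / 2) := Real.log_pos (by norm_num)
  rcases le_or_gt y 1 with h | h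
  · have : ∀ j ∈ Finset.range M, max (y - (3 / 2 : ℝ) ^ (j + 1)) 0 = 0 := fun j _ => by
      refine max_eq_right ?_
      have : (1 : ℝ) ≤ (3 / 2 : ℝ) ^ (j + 1) := one_le_pow₀ (by norm_num)
      linarith
    rw [Finset.sum_eq_zero this]
    positivity
  have hly := Real.log_pos h
  have e : Real.log 2 / Real.log (3 / 2) * |y * Real.logb 2 (1 / y)|
      = y * (Real.log y / Real.log (3 / 2)) := by
    rw [Real.logb, one_div, Real.log_inv, abs_mul, abs_div, abs_neg, abs_of_pos hly, abs_of_pos hl,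
      abs_of_nonneg hy]
    field_simp
  rw [e]
  set N := ⌊Real.log y / Real.log (3 / 2)⌋₊ with hN
  have hNle : (N : ℝ) ≤ Real.log y / Real.log (3 / 2) := Nat.floor_le (by positivity)
  calc _ ≤ ∑ j ∈ Finset.range M, if j ∈ Finset.range N then y else 0 := by
        refine Finset.sum_le_sum fun j _ => ?_
        split_ifs with hj
        · refine max_le ?_ hy
          have : (0 : ℝ) ≤ (3 / 2 : ℝ) ^ (j + 1) := by positivity
          linarith
        · refine max_le ?_ le_rfl
          rw [Finset.mem_range, not_lt] at hj
          have h1 : Real.log y / Real.log (3 / 2) < j + 1 :=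
            (Nat.lt_floor_add_one _).trans_le (by exact_mod_cast Nat.succ_le_succ hj)
          rw [div_lt_iff₀ hl'] at h1
          have h2 : Real.log y < Real.log ((3 / 2 : ℝ) ^ (j + 1)) := by
            rw [Real.log_pow]; exact_mod_cast h1
          have := (Real.log_lt_log_iff (by linarith) (by positivity)).1 h2
          linarith
    _ ≤ ∑ j ∈ Finset.range N, y := by
        rw [← Finset.sum_filter]
        refine Finset.sum_le_sum_of_subset_of_nonneg ?_ fun _ _ _ => hy
        intro j hj
        exact (Finset.mem_filter.1 hj).2
    _ = y * N := by simp [mul_comm]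
    _ ≤ _ := by gcongr

lemma lower (hf0 : ∀ x, 0 ≤ f x) (hfi : Integrable f) (h1 : ∫ x, f x = 1)
    (hF : ∀ x, F x = ∫ y in Set.Iic x, f y) (hbot : Tendsto F atBot (𝓝 0))
    (htop : Tendsto F atTop (𝓝 1))
    (hint : Integrable (fun x => f x * Real.logb 2 (1 / f x)) volume) :
    ∃ C : ℝ, ∀ M : ℕ, M - C ≤ ∑ t ∈ Finset.range M, bt F (((2 : ℝ) ^ M)⁻¹) t := by
  refine ⟨(∫ x, Real.log 2 / Real.log (3 / 2) * |f x * Real.logb 2 (1 / f x)|) + 8, fun M => ?_⟩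
  have hgi : ∀ K : ℝ, 0 ≤ K → Integrable fun x => max (f x - K) 0 := fun K hK => by
    refine hfi.mono' ((hfi.aestronglyMeasurable.sub aestronglyMeasurable_const).sup
      aestronglyMeasurable_const) (Eventually.of_forall fun x => ?_)
    rw [Real.norm_of_nonneg (le_max_right _ _)]
    exact max_le (by linarith) (hf0 x)
  have hb : ∑ t ∈ Finset.range M, (1 - bt F (((2 : ℝ) ^ M)⁻¹) t)
      ≤ ∑ t ∈ Finset.range M, ((∫ x, max (f x - (3 / 2 : ℝ) ^ (M - 1 - t + 1)) 0)
        + 2 * (3 / 4) ^ (M - 1 - t + 1)) := by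
    refine Finset.sum_le_sum fun t ht => ?_
    have := good_le hf0 hfi h1 hF hbot htop (ε := ((2 : ℝ) ^ M)⁻¹)
      (K := (3 / 2 : ℝ) ^ (M - 1 - t + 1)) (by positivity) (by positivity) t
    refine this.trans (le_of_eq ?_)
    congr 1
    obtain ⟨r, hr⟩ : ∃ r, M = r + 1 + t := ⟨M - 1 - t, by rw [Finset.mem_range] at ht; omega⟩
    have hr' : M - 1 - t = r := by omega
    rw [hr', hr, pow_add _ (r + 1) t, show (3 / 4 : ℝ) = 3 / 2 / 2 by norm_num, div_pow (3 / 2 : ℝ)]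
    field_simp
  rw [Finset.sum_range_reflect (fun j => (∫ x, max (f x - (3 / 2 : ℝ) ^ (j + 1)) 0)
        + 2 * (3 / 4 : ℝ) ^ (j + 1)) M, Finset.sum_sub_distrib, Finset.sum_add_distrib,
    ← integral_finsetSum _ fun j _ => hgi _ (by positivity)] at hb
  have g1 : ∑ j ∈ Finset.range M, 2 * (3 / 4 : ℝ) ^ (j + 1) ≤ 8 := by
    have : ∀ M : ℕ, ∑ j ∈ Finset.range M, 2 * (3 / 4 : ℝ) ^ (j + 1) = 6 - 6 * (3 / 4) ^ M := by
      intro M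
      induction M with
      | zero => simp
      | succ k ih => rw [Finset.sum_range_succ, ih]; ring
    rw [this]
    have : (0 : ℝ) ≤ (3 / 4) ^ M := by positivity
    linarith
  have g2 : ∫ x, ∑ j ∈ Finset.range M, max (f x - (3 / 2 : ℝ) ^ (j + 1)) 0
      ≤ ∫ x, Real.log 2 / Real.log (3 / 2) * |f x * Real.logb 2 (1 / f x)| :=
    integral_mono (integrable_finsetSum _ fun j _ => hgi _ (by positivity))
      (hint.abs.const_mul _) fun x => sum_max_le (hf0 x) M
  simp only [Finset.sum_const, Finset.card_range, nsmul_eq_mul, mul_one] at hb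
  linarith

end
end InvBits

open InvBits

/-- if `X` is a real random variable with density `f` satisfying Rényi's
condition (`⌊X⌋` has finite Shannon entropy) and `f·log₂(1/f)` Lebesgue integrable, and
`F` is its cumulative distribution function, then the expected bit-consumption of the
inversion method satisfies `limsup_{ε→0⁺} (N(ε) − log₂(1/ε)) ≤ 𝔈(f) + 2`. -/
theorem inversion_bits_upper_bound
    {Ω : Type} [MeasurableSpace Ω] (μ : Measure Ω) [IsProbabilityMeasure μ]
    (X : Ω → ℝ) (hX : Measurable X)
    (f : ℝ → ℝ) (hf_meas : Measurable f) (hf_nonneg : ∀ x, 0 ≤ f x)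
    (hdensity : Measure.map X μ = volume.withDensity fun x => ENNReal.ofReal (f x))
    (hrenyi : Summable fun k : ℤ => entTerm (μ (X ⁻¹' Set.Ico (k : ℝ) ((k : ℝ) + 1))).toReal)
    (hint : Integrable (fun x => f x * Real.logb 2 (1 / f x)) volume)
    (F : ℝ → ℝ) (hF : ∀ x, F x = (μ (X ⁻¹' Set.Iic x)).toReal) :
    Filter.limsup (fun ε : ℝ => inversionBits F ε - Real.logb 2 (1 / ε))
        (nhdsWithin 0 (Set.Ioi 0))
      ≤ (∫ x, f x * Real.logb 2 (1 / f x)) + 2 := by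
  have hmass : ∀ s : Set ℝ, MeasurableSet s →
      μ (X ⁻¹' s) = ∫⁻ x in s, ENNReal.ofReal (f x) := fun s hs => by
    rw [← Measure.map_apply hX hs, hdensity, withDensity_apply _ hs]
  have hfi : Integrable f := by
    refine ⟨hf_meas.aestronglyMeasurable, ?_⟩
    rw [hasFiniteIntegral_iff_ofReal (Eventually.of_forall hf_nonneg)]
    have := hmass Set.univ MeasurableSet.univ
    simp only [Set.preimage_univ, measure_univ, Measure.restrict_univ] at this
    rw [← this]; exact ENNReal.one_lt_top
  have hmassR : ∀ s : Set ℝ, MeasurableSet s → (μ (X ⁻¹' s)).toReal = ∫ x in s, f x :=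
    fun s hs => by
    rw [hmass s hs, integral_eq_lintegral_of_nonneg_ae (Eventually.of_forall hf_nonneg)
      hf_meas.aestronglyMeasurable]
  have h1 : ∫ x, f x = 1 := by
    have := hmassR Set.univ MeasurableSet.univ
    simp only [Set.preimage_univ, measure_univ, Measure.restrict_univ] at this
    rw [← this]; simp
  have hF' : ∀ x, F x = ∫ y in Set.Iic x, f y := fun x => by
    rw [hF, hmassR _ measurableSet_Iic]
  haveI : IsProbabilityMeasure (Measure.map X μ) :=
    Measure.isProbabilityMeasure_map hX.aemeasurable
  have hcdf : F = ProbabilityTheory.cdf (Measure.map X μ) := by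
    ext x
    rw [ProbabilityTheory.cdf_eq_real, measureReal_def, Measure.map_apply hX measurableSet_Iic, hF]
  have hbot : Tendsto F atBot (𝓝 0) := by
    rw [hcdf]; exact ProbabilityTheory.tendsto_cdf_atBot _
  have htop : Tendsto F atTop (𝓝 1) := by
    rw [hcdf]; exact ProbabilityTheory.tendsto_cdf_atTop _
  have hm := F_mono hf_nonneg hfi hF'
  have hP : Summable fun k : ℤ => entTerm (cm f 1 k) := by
    refine hrenyi.congr fun k => ?_
    rw [hmassR _ measurableSet_Ico, cm, cell_eq one_ne_zero]
    simp
  have hpm : ∀ n : ℕ, n ≠ 0 → ∀ m : ℤ,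
      F (((m : ℝ) + 1) / n) - F ((m : ℝ) / n) = cm f n m := fun n hn m => by
    rw [hF', hF', intervalIntegral.integral_Iic_sub_Iic hfi.integrableOn hfi.integrableOn,
      intervalIntegral.integral_of_le (by gcongr; linarith), cm, cell_eq hn,
      integral_Ico_eq_integral_Ioc]
  have bound : ∀ (n : ℕ) (ε : ℝ), n ≠ 0 → (1 : ℝ) / n ≤ 2 * ε →
      (Summable fun m => entTerm (cm f n m)) → ∀ T : ℕ,
      ∑ t ∈ Finset.range T, bt F ε t ≤ ∑' m, entTerm (cm f n m) + 3 := fun n ε hn hε hs T =>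
    sum_bt_le hm hbot htop hn hε (hpm n hn) (cm_nonneg hf_nonneg n)
      (cm_le_one hf_nonneg hfi h1 n) (hasSum_cm hfi h1 n) hs T
  set E := ∫ x, f x * Real.logb 2 (1 / f x) with hE
  -- the number of pieces
  have hN : Tendsto (fun ε : ℝ => ⌈1 / (2 * ε)⌉₊) (𝓝[>] 0) atTop := by
    refine tendsto_nat_ceil_atTop.comp ?_
    have h2 : Tendsto (fun ε : ℝ => (1 / 2) * ε⁻¹) (𝓝[>] 0) atTop :=
      tendsto_inv_nhdsGT_zero.const_mul_atTop (by norm_num)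
    refine h2.congr fun ε => ?_
    rw [one_div, one_div, mul_inv]
  have hpos : ∀ᶠ ε : ℝ in 𝓝[>] 0, 0 < ε := self_mem_nhdsWithin
  have hstep : ∀ ε : ℝ, 0 < ε → ⌈1 / (2 * ε)⌉₊ ≠ 0 ∧ (1 : ℝ) / ⌈1 / (2 * ε)⌉₊ ≤ 2 * ε := by
    intro ε hε
    have hp : 0 < 1 / (2 * ε) := by positivity
    have h2 := Nat.le_ceil (1 / (2 * ε))
    refine ⟨(Nat.ceil_pos.2 hp).ne', ?_⟩
    rw [div_le_comm₀ (hp.trans_le h2) (by positivity)]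
    exact h2
  refine le_of_forall_pos_le_add fun δ hδ => ?_
  refine limsup_le_of_le ?_ ?_
  · obtain ⟨C, hC⟩ := lower hf_nonneg hfi h1 hF' hbot htop hint
    refine IsCoboundedUnder.of_frequently_ge (a := -C) ?_
    have hseq : Tendsto (fun M : ℕ => ((2 : ℝ) ^ M)⁻¹) atTop (𝓝[>] 0) := by
      refine tendsto_nhdsWithin_iff.2 ⟨?_, Eventually.of_forall fun M => ?_⟩
      · exact (tendsto_pow_atTop_atTop_of_one_lt (by norm_num : (1 : ℝ) < 2)).inv_tendsto_atTop
      · simp only [Set.mem_Ioi]; positivity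
    refine hseq.frequently (Eventually.frequently ?_)
    filter_upwards [hseq.eventually (hN.eventually (renyi hf_nonneg hfi h1 hP hint one_pos))]
      with M hM
    have hε : (0 : ℝ) < ((2 : ℝ) ^ M)⁻¹ := by positivity
    obtain ⟨g1, g2⟩ := hstep _ hε
    have hsum : Summable (bt F (((2 : ℝ) ^ M)⁻¹)) :=
      summable_of_sum_range_le (bt_nonneg F _) (bound _ _ g1 g2 hM.1)
    have := (hC M).trans (hsum.sum_le_tsum _ fun t _ => bt_nonneg F _ t)
    rw [inversionBits_eq, one_div, inv_inv, Real.logb_pow, Real.logb_self_eq_one (by norm_num)]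
    linarith
  · have hlog : ∀ᶠ ε : ℝ in 𝓝[>] 0, Real.logb 2 (1 / 2 + ε) < -1 + δ / 2 := by
      have hc : Tendsto (fun ε : ℝ => Real.logb 2 (1 / 2 + ε)) (𝓝 0) (𝓝 (Real.logb 2 (1 / 2 + 0))) := by
        have : ContinuousAt (fun ε : ℝ => Real.log (1 / 2 + ε) / Real.log 2) 0 := by
          refine ContinuousAt.div_const (ContinuousAt.log (by fun_prop) (by norm_num)) _
        exact this
      have hv : Real.logb 2 (1 / 2 + 0) = -1 := by
        rw [add_zero, one_div, Real.logb_inv, Real.logb_self_eq_one (by norm_num)]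
      rw [hv] at hc
      exact (hc.mono_left nhdsWithin_le_nhds).eventually (gt_mem_nhds (by linarith))
    filter_upwards [hN.eventually (renyi hf_nonneg hfi h1 hP hint (half_pos hδ)), hlog, hpos]
      with ε hr hl hε
    obtain ⟨g1, g2⟩ := hstep _ hε
    have u1 : inversionBits F ε ≤ _ :=
      Real.tsum_le_of_sum_range_le (bt_nonneg F ε) (bound _ _ g1 g2 hr.1)
    have u2 : Real.logb 2 (⌈1 / (2 * ε)⌉₊ : ℝ) ≤ Real.logb 2 (1 / ε) + Real.logb 2 (1 / 2 + ε) := by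
      rw [← Real.logb_mul (by positivity) (by positivity)]
      refine Real.logb_le_logb_of_le (by norm_num) (by exact_mod_cast Nat.pos_of_ne_zero g1) ?_
      have := (Nat.ceil_lt_add_one (show 0 ≤ 1 / (2 * ε) by positivity)).le
      refine this.trans (le_of_eq ?_)
      field_simp
    linarith [hr.2]
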